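/- arXiv:1109.6432 — 6 statements merged into one kernel-verified Lean document; each statement's English description precedes it below -/
import Mathlib

section
/- Let P = ∑_{i=0}^m a_i X^i ∈ ℤ[X]. Then every prime p ∈ S_P satisfies p ≤ deg P or p divides gcd(a_0, a_1, …, a_m); that is, S_P ⊆ [1, deg P] ∪ Π(gcd_i a_i), where Π(n) is the set of prime divisors of n. -/
/-- `SP P` is the set of primes `p` such that `p` divides `P(m)` for every integer `m`. -/
def SP (P : Polynomial ℤ) : Set ℕ :=
  {p | p.Prime ∧ ∀ m : ℤ, (p : ℤ) ∣ P.eval m}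

/-- Every prime `p ∈ S_P` satisfies `p ≤ deg P` or `p` divides the gcd of the
coefficients of `P` (i.e. the content of `P`). -/
theorem stmt1 (P : Polynomial ℤ) (p : ℕ) (hp : p ∈ SP P) :
    p ≤ P.natDegree ∨ (p : ℤ) ∣ P.content := by
  obtain ⟨hprime, hdvd⟩ := hp
  have : Fact p.Prime := ⟨hprime⟩
  refine or_iff_not_imp_left.2 fun hlt => ?_
  have hzero : P.map (Int.castRingHom (ZMod p)) = 0 := by
    refine Polynomial.eq_zero_of_natDegree_lt_card_of_eval_eq_zero _
      (Function.injective_id (α := ZMod p)) (fun x => ?_) ?_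
    · obtain ⟨m, rfl⟩ := ZMod.intCast_surjective x
      have h := (ZMod.intCast_zmod_eq_zero_iff_dvd (P.eval m) p).2 (hdvd m)
      simpa [Polynomial.eval_intCast_map] using h
    · rw [ZMod.card]
      exact Polynomial.natDegree_map_le.trans_lt (not_le.1 hlt)
  rw [Polynomial.dvd_content_iff_C_dvd, Polynomial.C_dvd_iff_dvd_coeff]
  intro i
  rw [← ZMod.intCast_zmod_eq_zero_iff_dvd]
  simpa using congrArg (fun Q => Q.coeff i) hzero
end

section
/- Let Γ be a finitely generated subgroup of GL_n(ℚ) each of whose elements is upper unitriangular (all diagonal entries equal to 1 and all entries below the diagonal equal to 0). Then Γ, viewed as a set of n×n real matrices, is a discrete subset of the space of n×n real matrices: every γ ∈ Γ has a neighborhood in M_n(ℝ) whose intersection with Γ is {γ}. -/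
/-- A rational matrix is upper unitriangular if all diagonal entries equal `1` and all
entries below the diagonal equal `0`. -/
def IsUnitriangular {n : ℕ} (A : Matrix (Fin n) (Fin n) ℚ) : Prop :=
  (∀ i, A i i = 1) ∧ ∀ i j : Fin n, j < i → A i j = 0

/-- Matrices whose `(i, j)` entry lies in `D ^ i / D ^ j * ℤ`; equivalently, the conjugates of
integer matrices by the diagonal matrix with entries `D ^ i`. -/
def scaledIntegralSubmonoid (n : ℕ) (D : ℤ) (hD : D ≠ 0) :
    Submonoid (Matrix (Fin n) (Fin n) ℚ) where
  carrier := {A | ∀ i j : Fin n, ∃ z : ℤ, (D : ℚ) ^ (j : ℕ) * A i j = z * (D : ℚ) ^ (i : ℕ)}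
  one_mem' i j := by
    by_cases h : i = j
    · subst h
      exact ⟨1, by simp⟩
    · exact ⟨0, by simp [Matrix.one_apply_ne h]⟩
  mul_mem' {A B} hA hB i j := by
    choose a ha using hA
    choose b hb using hB
    refine ⟨∑ k, a i k * b k j, ?_⟩
    rw [Matrix.mul_apply, Finset.mul_sum]
    push_cast
    rw [Finset.sum_mul]
    refine Finset.sum_congr rfl fun k _ => ?_
    have hk : (D : ℚ) ^ (k : ℕ) ≠ 0 := pow_ne_zero _ (Int.cast_ne_zero.mpr hD)
    apply mul_left_cancel₀ hk
    linear_combination (D : ℚ) ^ (j : ℕ) * B k j * ha i k +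
      a i k * (D : ℚ) ^ (i : ℕ) * hb k j

theorem IsUnitriangular.mem_scaledIntegralSubmonoid {n : ℕ} {D : ℤ} (hD : D ≠ 0)
    {A : Matrix (Fin n) (Fin n) ℚ} (hA : IsUnitriangular A)
    (hint : ∀ i j, ∃ w : ℤ, (w : ℚ) = D * A i j) : A ∈ scaledIntegralSubmonoid n D hD := by
  intro i j
  rcases lt_trichotomy i j with h | h | h
  · obtain ⟨w, hw⟩ := hint i j
    obtain ⟨k, hk⟩ := Nat.exists_eq_add_of_lt (Fin.lt_def.mp h)
    refine ⟨D ^ k * w, ?_⟩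
    push_cast
    rw [hk, hw]
    ring
  · subst h
    exact ⟨1, by rw [hA.1]; ring⟩
  · exact ⟨0, by rw [hA.2 i j h]; simp⟩

/-- A finite set of rational matrices has a common denominator. -/
theorem exists_common_denominator {n : ℕ} {T : Set (Matrix.GeneralLinearGroup (Fin n) ℚ)}
    (hT : T.Finite) : ∃ D : ℤ, D ≠ 0 ∧ ∀ t ∈ T, ∀ i j, ∃ w : ℤ,
      (w : ℚ) = D * (t : Matrix (Fin n) (Fin n) ℚ) i j := by
  have := hT.to_subtype
  obtain ⟨D, hD⟩ := IsLocalization.exist_integer_multiples_of_finite (nonZeroDivisors ℤ)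
    (fun p : T × Fin n × Fin n => (p.1.1 : Matrix (Fin n) (Fin n) ℚ) p.2.1 p.2.2)
  refine ⟨D, nonZeroDivisors.coe_ne_zero D, fun t ht i j => ?_⟩
  obtain ⟨w, hw⟩ := hD (⟨t, ht⟩, i, j)
  exact ⟨w, by simpa [zsmul_eq_mul] using hw⟩

/-- Two distinct entries of scaled integral matrices are at distance at least `|D| ^ (-n)`. -/
theorem scaledIntegralSubmonoid_eq_of_close {n : ℕ} {D : ℤ} {hD : D ≠ 0}
    {A B : Matrix (Fin n) (Fin n) ℚ} (hA : A ∈ scaledIntegralSubmonoid n D hD)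
    (hB : B ∈ scaledIntegralSubmonoid n D hD)
    (h : ∀ i j, |(D : ℚ)| ^ n * |A i j - B i j| < 1) : A = B := by
  ext i j
  obtain ⟨a, ha⟩ := hA i j
  obtain ⟨b, hb⟩ := hB i j
  have hDq : (D : ℚ) ≠ 0 := Int.cast_ne_zero.mpr hD
  have key : (D : ℚ) ^ n * (A i j - B i j) =
      (((a - b) * D ^ (i : ℕ) * D ^ (n - j) : ℤ) : ℚ) := by
    have hn : (D : ℚ) ^ n = D ^ (n - j) * D ^ (j : ℕ) := by
      rw [← pow_add, Nat.sub_add_cancel j.isLt.le]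
    push_cast
    rw [hn]
    linear_combination (D : ℚ) ^ (n - j) * (ha - hb)
  have hlt := h i j
  rw [← abs_pow, ← abs_mul, key, ← Int.cast_abs] at hlt
  have hz := Int.abs_lt_one_iff.mp (by exact_mod_cast hlt)
  rw [hz, Int.cast_zero] at key
  exact sub_eq_zero.mp ((mul_eq_zero.mp key).resolve_left (pow_ne_zero _ hDq))

theorem exists_le_comap_scaledIntegralSubmonoid {n : ℕ}
    {Γ : Subgroup (Matrix.GeneralLinearGroup (Fin n) ℚ)} (hfg : Γ.FG)
    (htri : ∀ γ ∈ Γ, IsUnitriangular (γ : Matrix (Fin n) (Fin n) ℚ)) :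
    ∃ (D : ℤ) (hD : D ≠ 0), ∀ γ ∈ Γ,
      (γ : Matrix (Fin n) (Fin n) ℚ) ∈ scaledIntegralSubmonoid n D hD := by
  obtain ⟨T, hT, hfin⟩ := (Submonoid.fg_iff _).mp ((Subgroup.fg_iff_submonoid_fg Γ).mp hfg)
  obtain ⟨D, hD, hint⟩ := exists_common_denominator hfin
  refine ⟨D, hD, fun γ hγ => ?_⟩
  have hle : Submonoid.closure T ≤
      (scaledIntegralSubmonoid n D hD).comap (Units.coeHom (Matrix (Fin n) (Fin n) ℚ)) :=
    Submonoid.closure_le.mpr fun t ht =>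
      (htri t (hT.le (Submonoid.subset_closure ht))).mem_scaledIntegralSubmonoid hD (hint t ht)
  exact hle (hT.ge hγ)

/-- A finitely generated group of upper unitriangular rational matrices is discrete in the
space of `n × n` real matrices: every `γ ∈ Γ` has a neighborhood (in `M_n(ℝ)`) meeting
(the image of) `Γ` only in `γ`. -/
theorem stmt4 (n : ℕ) (Γ : Subgroup (Matrix.GeneralLinearGroup (Fin n) ℚ)) (hfg : Γ.FG)
    (htri : ∀ γ ∈ Γ, IsUnitriangular (γ : Matrix (Fin n) (Fin n) ℚ)) :
    ∀ γ ∈ Γ, ∃ U : Set (Matrix (Fin n) (Fin n) ℝ),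
      U ∈ nhds ((γ : Matrix (Fin n) (Fin n) ℚ).map (Rat.cast : ℚ → ℝ)) ∧
      ∀ γ' ∈ Γ, ((γ' : Matrix (Fin n) (Fin n) ℚ).map (Rat.cast : ℚ → ℝ)) ∈ U →
        (γ' : Matrix (Fin n) (Fin n) ℚ) = (γ : Matrix (Fin n) (Fin n) ℚ) := by
  obtain ⟨D, hD, hmem⟩ := exists_le_comap_scaledIntegralSubmonoid hfg htri
  intro γ hγ
  refine ⟨{B | ∀ i j, |(D : ℝ)| ^ n *
    |B i j - ((γ : Matrix (Fin n) (Fin n) ℚ) i j : ℝ)| < 1}, ?_, fun γ' hγ' hU => ?_⟩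
  · refine IsOpen.mem_nhds ?_ fun i j => by simp
    simp only [Set.ofPred_forall]
    exact isOpen_iInter_of_finite fun i => isOpen_iInter_of_finite fun j =>
      isOpen_lt (by fun_prop) continuous_const
  · exact scaledIntegralSubmonoid_eq_of_close (hmem γ' hγ') (hmem γ hγ) fun i j => by
      have h := hU i j
      rw [Matrix.map_apply] at h
      exact (Rat.cast_lt (K := ℝ)).mp (by push_cast; exact h)
end

section
/- Let A be an integral domain of characteristic zero that is finitely generated as a ℤ-algebra. Then there exists a finite set S of primes such that, writing ℤ_S for the localization of ℤ at the multiplicative set generated by the primes in S, the ℤ_S-algebra A_S = A ⊗_ℤ ℤ_S is a free ℤ_S-module; moreover there exist elements x_1, …, x_d ∈ A whose images in A ⊗_ℤ ℚ are algebraically independent over ℚ, such that A_S is a finitely generated module over the ℤ_S-subalgebra of A_S generated by (the images of) x_1, …, x_d. -/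
open scoped TensorProduct

set_option synthInstance.maxHeartbeats 1000000
set_option maxHeartbeats 1000000

/-- The ring of `S`-integers: the subring of `ℚ` obtained from `ℤ` by inverting the
primes in `S`. -/
def ZS (S : Finset ℕ) : Subring ℚ :=
  Subring.closure (Set.range (Int.cast : ℤ → ℚ) ∪ {x : ℚ | ∃ p ∈ S, x = (p : ℚ)⁻¹})

universe u

/-- `M` becomes free, up to `s`-power torsion, after inverting a single nonzero `s`: it contains a
linearly independent family whose span contains an `s`-power multiple of every element. -/
def GenericallyFree (k : Type*) (M : Type u) [CommRing k] [AddCommGroup M] [Module k M] : Prop :=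
  ∃ s : k, s ≠ 0 ∧ ∃ (ι : Type u) (b : ι → M), LinearIndependent k b ∧
    ∀ m, ∃ r : ℕ, s ^ r • m ∈ Submodule.span k (Set.range b)

/-- Every finite module over the `k`-algebra `R` is generically free over `k`. -/
def HasGenericFreeness (k : Type*) (R : Type*) [CommRing k] [CommRing R] [Algebra k R] : Prop :=
  ∀ (M : Type u) [AddCommGroup M] [Module k M] [Module R M] [IsScalarTower k R M]
    [Module.Finite R M], GenericallyFree k M

section Filtration

variable {k R : Type*} {M : Type u} [CommRing k] [CommRing R] [AddCommGroup M] [Module k M]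
  [Module R M] {F : ℕ → Submodule R M} {ι : ℕ → Type u} {c : ∀ n, ι n → M}

theorem linearIndependent_sigma_of_filtration [Algebra k R] [IsScalarTower k R M] (hF : Monotone F)
    (hc : ∀ n i, c n i ∈ F (n + 1))
    (hli : ∀ n, LinearIndependent k fun i => (F n).mkQ (c n i)) :
    LinearIndependent k fun x : Σ n, ι n => c x.1 x.2 := by
  classical
  rw [linearIndependent_iff]
  suffices H : ∀ (N : ℕ) (l : (Σ n, ι n) →₀ k), (∀ x ∈ l.support, x.1 < N) →
      Finsupp.linearCombination k (fun x : Σ n, ι n => c x.1 x.2) l = 0 → l = 0 by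
    intro l hl
    refine H (l.support.sup (fun x => x.1) + 1) l (fun x hx => ?_) hl
    exact Nat.lt_succ_of_le (Finset.le_sup (f := fun x : Σ n, ι n => x.1) hx)
  intro N
  induction N with
  | zero =>
    exact fun l hl _ => Finsupp.support_eq_empty.1
      (Finset.eq_empty_of_forall_notMem fun x hx => absurd (hl x hx) (Nat.not_lt_zero _))
  | succ N ih =>
    intro l hl h0
    have hdec := Finsupp.filter_add_filter_not l (fun x => x.1 = N)
    have htop : l.filter (fun x => x.1 = N) = (l.split N).mapDomain (Sigma.mk N) := by
      ext ⟨n, i⟩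
      by_cases hn : n = N
      · subst hn
        rw [Finsupp.filter_apply, if_pos rfl, Finsupp.mapDomain_apply sigma_mk_injective,
          Finsupp.split_apply]
      · rw [Finsupp.filter_apply, if_neg hn, Finsupp.mapDomain_of_notMem_range]
        rintro ⟨j, hj⟩
        exact hn (congrArg Sigma.fst hj).symm
    have hlow : Finsupp.linearCombination k (fun x : Σ n, ι n => c x.1 x.2)
        (l.filter fun x => ¬ x.1 = N) ∈ F N := by
      rw [Finsupp.linearCombination_apply]
      refine Submodule.sum_mem _ fun x hx => ?_
      rw [Finsupp.support_filter, Finset.mem_filter] at hx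
      have := hl x hx.1
      exact Submodule.smul_of_tower_mem _ _ (hF (by lia) (hc x.1 x.2))
    have hsplit : l.split N = 0 := by
      refine linearIndependent_iff.1 (hli N) _ ?_
      have : Finsupp.linearCombination k (fun i => (F N).mkQ (c N i)) (l.split N) =
          (F N).mkQ (Finsupp.linearCombination k (fun x : Σ n, ι n => c x.1 x.2)
            (l.filter fun x => x.1 = N)) := by
        rw [htop, Finsupp.linearCombination_mapDomain, Finsupp.linearCombination_apply,
          Finsupp.linearCombination_apply, map_finsuppSum]
        rfl
      rw [this, ← LinearMap.mem_ker, Submodule.ker_mkQ]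
      rw [← hdec, map_add] at h0
      rw [eq_neg_of_add_eq_zero_left h0]
      exact neg_mem hlow
    rw [htop, hsplit, Finsupp.mapDomain_zero, zero_add] at hdec
    refine ih l (fun x hx => ?_) h0
    have := hl x hx
    rw [← hdec, Finsupp.support_filter, Finset.mem_filter] at hx
    have := hx.2
    lia

theorem exists_pow_smul_mem_span_sigma_of_filtration {s : k} (h0 : F 0 = ⊥)
    (hs : ∀ n, ∀ m ∈ F (n + 1), ∃ r : ℕ, ∃ y ∈ Submodule.span k (Set.range (c n)),
      s ^ r • m - y ∈ F n) (n : ℕ) (m : M) (hm : m ∈ F n) :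
    ∃ r : ℕ, s ^ r • m ∈ Submodule.span k (Set.range fun x : Σ n, ι n => c x.1 x.2) := by
  induction n generalizing m with
  | zero =>
    rw [h0, Submodule.mem_bot] at hm
    exact ⟨0, by simp [hm]⟩
  | succ n ih =>
    obtain ⟨r, y, hy, hmy⟩ := hs n m hm
    obtain ⟨t, ht⟩ := ih _ hmy
    refine ⟨t + r, ?_⟩
    have hy' : y ∈ Submodule.span k (Set.range fun x : Σ n, ι n => c x.1 x.2) :=
      Submodule.span_mono (by rintro _ ⟨i, rfl⟩; exact ⟨⟨n, i⟩, rfl⟩) hy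
    rw [smul_sub] at ht
    rw [pow_add, mul_smul]
    simpa using add_mem ht (Submodule.smul_mem _ (s ^ t) hy')

end Filtration

section Induction

variable {k R : Type*} [CommRing k] [CommRing R] [Algebra k R]

theorem hasGenericFreeness_of_finite [IsDomain k] [Module.Finite k R] :
    HasGenericFreeness.{u} k R := by
  intro M _ _ _ _ _
  have : Module.Finite k M := .trans R M
  obtain ⟨S, hS⟩ := Module.Finite.fg_top (R := k) (M := M)
  obtain ⟨t, ht, hmax⟩ := exists_maximal_linearIndepOn k (id : M → M)
  have key : ∀ m : M, ∃ a : k, a ≠ 0 ∧ a • m ∈ Submodule.span k t := by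
    intro m
    by_cases hm : m ∈ t
    · exact ⟨1, one_ne_zero, by simpa using Submodule.subset_span hm⟩
    · simpa using hmax m hm
  choose a ha hat using key
  refine ⟨∏ m ∈ S, a m, Finset.prod_ne_zero_iff.2 fun m _ => ha m, t, Subtype.val, ht,
    fun m => ⟨1, ?_⟩⟩
  rw [pow_one, Subtype.range_coe]
  have hm : m ∈ Submodule.span k (S : Set M) := hS ▸ Submodule.mem_top
  induction hm using Submodule.span_induction with
  | mem x hx =>
    obtain ⟨q, hq⟩ := Finset.dvd_prod_of_mem a hx
    rw [hq, mul_comm, mul_smul]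
    exact Submodule.smul_mem _ _ (hat x)
  | zero => simp
  | add x y _ _ hx hy => rw [smul_add]; exact add_mem hx hy
  | smul q x _ hx => rw [smul_comm]; exact Submodule.smul_mem _ _ hx

theorem HasGenericFreeness.of_surjective {T : Type*} [CommRing T] [Algebra k T]
    (h : HasGenericFreeness.{u} k R) (f : R →ₐ[k] T) (hf : Function.Surjective f) :
    HasGenericFreeness.{u} k T := by
  intro M _ _ _ _ _
  let := Module.compHom M (f : R →+* T)
  have hsmul (r : R) (m : M) : r • m = f r • m := rfl
  have : IsScalarTower k R M := ⟨fun a r m => by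
    rw [hsmul, hsmul, map_smul, smul_assoc]⟩
  have : Module.Finite R M := by
    obtain ⟨S, hS⟩ := Module.Finite.fg_top (R := T) (M := M)
    refine ⟨⟨S, eq_top_iff.2 fun m _ => ?_⟩⟩
    have hm : m ∈ Submodule.span T (S : Set M) := hS ▸ Submodule.mem_top
    induction hm using Submodule.span_induction with
    | mem x hx => exact Submodule.subset_span hx
    | zero => simp
    | add x y _ _ hx hy => exact add_mem (hx trivial) (hy trivial)
    | smul q x _ hx =>
      obtain ⟨r, rfl⟩ := hf q
      exact Submodule.smul_mem _ r (hx trivial)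
  exact h M

/-- The submodule generated by `N, f N, …, f ^ (n - 1) N`. -/
def iterateFiltration {M : Type*} [AddCommGroup M] [Module R M] (f : Module.End R M)
    (N : Submodule R M) : ℕ → Submodule R M
  | 0 => ⊥
  | n + 1 => iterateFiltration f N n ⊔ N.map (f ^ n)

section iterate
variable {M : Type*} [AddCommGroup M] [Module R M] (f : Module.End R M) (N : Submodule R M)

theorem iterateFiltration_mono : Monotone (iterateFiltration f N) :=
  monotone_nat_of_le_succ fun _ => le_sup_left

theorem map_iterateFiltration_le (n : ℕ) :
    (iterateFiltration f N n).map f ≤ iterateFiltration f N (n + 1) := by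
  induction n with
  | zero => simp [iterateFiltration]
  | succ n ih =>
    rw [iterateFiltration, Submodule.map_sup, ← Submodule.map_comp]
    refine sup_le (ih.trans (iterateFiltration_mono f N (by lia))) ?_
    rw [← Module.End.mul_eq_comp, ← pow_succ']
    exact le_sup_right

theorem iterateFiltration_comap_mono :
    Monotone fun n => ((iterateFiltration f N n).comap (f ^ n)).comap N.subtype := by
  refine monotone_nat_of_le_succ fun n y hy => ?_
  rw [Submodule.mem_comap, Submodule.mem_comap] at hy ⊢
  rw [pow_succ', Module.End.mul_apply]
  exact map_iterateFiltration_le f N n (Submodule.mem_map_of_mem hy)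

end iterate

theorem HasGenericFreeness.genericallyFree_of_iterate [IsDomain k] [IsNoetherianRing R]
    (h : HasGenericFreeness.{u} k R) {M : Type u} [AddCommGroup M] [Module k M] [Module R M]
    [IsScalarTower k R M] (f : Module.End R M) (N : Submodule R M) (hN : N.FG)
    (htop : ∀ m, ∃ n, m ∈ iterateFiltration f N n) : GenericallyFree k M := by
  have : Module.Finite R N := Module.Finite.iff_fg.2 hN
  set F := iterateFiltration f N
  let K : ℕ →o Submodule R N := ⟨_, iterateFiltration_comap_mono f N⟩
  obtain ⟨n₀, hn₀⟩ := monotone_stabilizes_iff_noetherian.2 (inferInstance : IsNoetherian R N) K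
  choose s hs ι b hb hspan using fun n => h (N ⧸ K n)
  have hK (n : ℕ) : K (min n n₀) = K n := by
    rcases le_total n n₀ with hn | hn
    · rw [min_eq_left hn]
    · rw [min_eq_right hn, hn₀ n hn]
  let t : k := ∏ n ∈ Finset.range (n₀ + 1), s n
  have ht : t ≠ 0 := Finset.prod_ne_zero_iff.2 fun n _ => hs n
  have hdata (n : ℕ) : ∃ (κ : Type u) (c : κ → N),
      LinearIndependent k (fun i => (K n).mkQ (c i)) ∧
      ∀ m : N, ∃ r : ℕ, ∃ y ∈ Submodule.span k (Set.range c), t ^ r • m - y ∈ K n := by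
    rw [← hK n]
    generalize hj : min n n₀ = j
    choose c hc using fun i => (K j).mkQ_surjective (b j i)
    refine ⟨ι j, c, by simpa only [hc] using hb j, fun m => ?_⟩
    obtain ⟨r, hr⟩ := hspan j ((K j).mkQ m)
    refine ⟨r, ?_⟩
    have hr' : t ^ r • (K j).mkQ m ∈ Submodule.span k (Set.range (b j)) := by
      obtain ⟨q, hq⟩ : s j ∣ t := Finset.dvd_prod_of_mem s (Finset.mem_range.2 (by lia))
      rw [hq, mul_comm, mul_pow, mul_smul]
      exact Submodule.smul_mem _ _ hr
    have hrange : Set.range (b j) = ((K j).mkQ.restrictScalars k) '' Set.range c := by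
      rw [← Set.range_comp]
      exact congrArg Set.range (funext fun i => (hc i).symm)
    rw [hrange, Submodule.span_image] at hr'
    obtain ⟨y, hy, hym⟩ := hr'
    refine ⟨y, hy, ?_⟩
    rw [← (K j).ker_mkQ, LinearMap.mem_ker, map_sub, LinearMap.map_smul_of_tower, sub_eq_zero]
    exact hym.symm
  choose κ c hc hct using hdata
  have hpow (n : ℕ) (y : N) : (f ^ n) y ∈ F (n + 1) :=
    Submodule.mem_sup_right (Submodule.mem_map_of_mem y.2)
  refine ⟨t, ht, Σ n, κ n, fun x => (f ^ x.1) (c x.1 x.2),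
    linearIndependent_sigma_of_filtration (c := fun n i => (f ^ n) (c n i))
      (iterateFiltration_mono f N) (fun n i => hpow n _) (fun n => ?_), fun m => ?_⟩
  · let g : (N ⧸ K n) →ₗ[R] M ⧸ F n := (K n).mapQ (F n) ((f ^ n) ∘ₗ N.subtype) le_rfl
    have hg : Function.Injective (g.restrictScalars k) := by
      change Function.Injective g
      rw [← LinearMap.ker_eq_bot]
      exact Submodule.ker_liftQ_eq_bot' _ _ (by rw [LinearMap.ker_comp, Submodule.ker_mkQ]; rfl)
    exact (hc n).map' (g.restrictScalars k) (LinearMap.ker_eq_bot.2 hg)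
  · obtain ⟨n, hn⟩ := htop m
    refine exists_pow_smul_mem_span_sigma_of_filtration (F := F)
      (c := fun n i => (f ^ n) (c n i)) rfl (fun n m hm => ?_) n m hn
    obtain ⟨z, hz, _, ⟨y, hy, rfl⟩, rfl⟩ := Submodule.mem_sup.1 hm
    obtain ⟨r, w, hw, hwK⟩ := hct n ⟨y, hy⟩
    refine ⟨r, (f ^ n) w, ?_, ?_⟩
    · have := Submodule.mem_map_of_mem (f := ((f ^ n) ∘ₗ N.subtype).restrictScalars k) hw
      rw [← Submodule.span_image, ← Set.range_comp] at this
      exact this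
    · have hwF : (f ^ n) (t ^ r • y - w) ∈ F n := hwK
      rw [map_sub, LinearMap.map_smul_of_tower] at hwF
      rw [smul_add, add_sub_assoc]
      exact add_mem (Submodule.smul_of_tower_mem _ _ hz) hwF

open Polynomial in
theorem HasGenericFreeness.polynomial [IsDomain k] [IsNoetherianRing R]
    (h : HasGenericFreeness.{u} k R) :
    HasGenericFreeness.{u} k R[X] := by
  intro M _ _ _ _ _
  let := Module.compHom M (C : R →+* R[X])
  have hsmul (r : R) (m : M) : r • m = (C r : R[X]) • m := rfl
  have : IsScalarTower k R M := ⟨fun a r m => by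
    rw [hsmul, hsmul, ← smul_C, smul_assoc]⟩
  obtain ⟨S, hS⟩ := Module.Finite.fg_top (R := R[X]) (M := M)
  let f : Module.End R M :=
    { toFun := fun m => (X : R[X]) • m
      map_add' := smul_add _
      map_smul' := fun r m => smul_comm (X : R[X]) (C r) m }
  let N := Submodule.span R (S : Set M)
  refine h.genericallyFree_of_iterate f N ⟨S, rfl⟩ fun m => ?_
  have hm : m ∈ Submodule.span R[X] (S : Set M) := hS ▸ Submodule.mem_top
  have hadd {x y : M} (hx : ∃ n, x ∈ iterateFiltration f N n)
      (hy : ∃ n, y ∈ iterateFiltration f N n) : ∃ n, x + y ∈ iterateFiltration f N n := by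
    obtain ⟨a, ha⟩ := hx
    obtain ⟨b, hb⟩ := hy
    exact ⟨max a b, add_mem (iterateFiltration_mono f N (le_max_left a b) ha)
      (iterateFiltration_mono f N (le_max_right a b) hb)⟩
  induction hm using Submodule.span_induction with
  | mem x hx =>
    exact ⟨1, Submodule.mem_sup_right ⟨x, Submodule.subset_span hx, rfl⟩⟩
  | zero => exact ⟨0, zero_mem _⟩
  | add x y _ _ hx hy => exact hadd hx hy
  | smul q x _ hx =>
    induction q using Polynomial.induction_on with
    | C r =>
      obtain ⟨n, hn⟩ := hx
      exact ⟨n, Submodule.smul_mem _ r hn⟩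
    | add p q hp hq => rw [add_smul]; exact hadd hp hq
    | monomial n r hr =>
      obtain ⟨a, ha⟩ := hr
      refine ⟨a + 1, ?_⟩
      rw [pow_succ', mul_left_comm, mul_smul]
      exact map_iterateFiltration_le f N a (Submodule.mem_map_of_mem ha)

theorem hasGenericFreeness_mvPolynomial [IsDomain k] [IsNoetherianRing k] (n : ℕ) :
    HasGenericFreeness.{u} k (MvPolynomial (Fin n) k) := by
  induction n with
  | zero =>
    have : Module.Finite k (MvPolynomial (Fin 0) k) :=
      .equiv (MvPolynomial.isEmptyAlgEquiv k (Fin 0)).symm.toLinearEquiv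
    exact hasGenericFreeness_of_finite
  | succ n ih =>
    exact ih.polynomial.of_surjective (MvPolynomial.finSuccEquiv k n).symm.toAlgHom
      (MvPolynomial.finSuccEquiv k n).symm.surjective

theorem genericallyFree_of_finiteType [IsDomain k] [IsNoetherianRing k] (A : Type u)
    [CommRing A] [Algebra k A] [Algebra.FiniteType k A] : GenericallyFree k A := by
  obtain ⟨n, f, hf⟩ := Algebra.FiniteType.iff_quotient_mvPolynomial''.1 ‹Algebra.FiniteType k A›
  exact (hasGenericFreeness_mvPolynomial n).of_surjective f hf A

end Induction
theorem free_baseChange_of_isUnit {k A : Type*} [CommRing k] [AddCommGroup A] [Module k A]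
    (B : Type*) [CommRing B] [Algebra k B] [Module.Flat k B] {s : k}
    (hs : IsUnit (algebraMap k B s)) {ι : Type*} {b : ι → A} (hb : LinearIndependent k b)
    (hspan : ∀ m, ∃ r : ℕ, s ^ r • m ∈ Submodule.span k (Set.range b)) :
    Module.Free B (B ⊗[k] A) := by
  let f := (Finsupp.linearCombination k b).baseChange B
  have hinj : Function.Injective f :=
    Module.Flat.lTensor_preserves_injective_linearMap _ hb
  have hsurj : Function.Surjective f := by
    rw [← LinearMap.range_eq_top, eq_top_iff]
    intro z _
    induction z with
    | zero => exact zero_mem _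
    | add x y hx hy => exact add_mem (hx trivial) (hy trivial)
    | tmul c m =>
      obtain ⟨r, hr⟩ := hspan m
      rw [← Finsupp.range_linearCombination] at hr
      obtain ⟨l, hl⟩ := hr
      have hu := hs.pow r
      refine ⟨(c * hu.unit⁻¹) ⊗ₜ l, ?_⟩
      rw [LinearMap.baseChange_tmul, hl, ← TensorProduct.smul_tmul, Algebra.smul_def, map_pow,
        mul_left_comm, hu.mul_val_inv, mul_one]
  exact .of_equiv (LinearEquiv.ofBijective f ⟨hinj, hsurj⟩)

section NoetherNormalization

variable {k : Type*} (K : Type*) {A : Type*} [CommRing k] [IsDomain k] [Field K] [Algebra k K]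
  [IsFractionRing k K] [CommRing A] [Algebra k A] [Module.IsTorsionFree k A]

theorem includeRight_injective_of_isFractionRing :
    Function.Injective (Algebra.TensorProduct.includeRight : A →ₐ[k] K ⊗[k] A) := by
  have := (isLocalizedModule_iff_isBaseChange (nonZeroDivisors k) K _).2
    (TensorProduct.isBaseChange k A K)
  intro a b hab
  obtain ⟨c, hc⟩ := (IsLocalizedModule.eq_iff_exists (nonZeroDivisors k)
    (TensorProduct.mk k K A 1)).1 hab
  exact smul_right_injective A (nonZeroDivisors.coe_ne_zero c) hc

theorem exists_algebraicIndependent_isIntegral [IsDomain A] [Algebra.FiniteType k A] :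
    ∃ (d : ℕ) (x : Fin d → A),
      AlgebraicIndependent K (fun i => ((1 : K) ⊗ₜ[k] x i : K ⊗[k] A)) ∧
      (MvPolynomial.aeval (R := K) fun i => ((1 : K) ⊗ₜ[k] x i : K ⊗[k] A)).IsIntegral := by
  have := (isLocalizedModule_iff_isBaseChange (nonZeroDivisors k) K _).2
    (TensorProduct.isBaseChange k A K)
  have : Nontrivial (K ⊗[k] A) := (includeRight_injective_of_isFractionRing (k := k) K).nontrivial
  obtain ⟨d, g, hg, hgint⟩ := exists_integral_inj_algHom_of_fg K (K ⊗[k] A)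
  choose p hp using fun i => IsLocalizedModule.surj (nonZeroDivisors k)
    (TensorProduct.mk k K A 1) (g (.X i))
  let N (i : Fin d) : K := algebraMap k K (p i).2
  have hN (i : Fin d) : N i ≠ 0 := IsFractionRing.to_map_ne_zero_of_mem_nonZeroDivisors (p i).2.2
  have hx (i : Fin d) : (1 : K) ⊗ₜ[k] (p i).1 = N i • g (.X i) := by
    rw [algebraMap_smul]
    exact (hp i).symm
  refine ⟨d, fun i => (p i).1, ?_, ?_⟩
  · have hX : AlgebraicIndependent K fun i => g (.X i) :=
      (MvPolynomial.algebraicIndependent_X (Fin d) K).map' hg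
    have := hX.polynomial_aeval_of_transcendental
      (f := fun i => Polynomial.C (N i) * Polynomial.X) fun i =>
        Polynomial.transcendental _ (by simp [Polynomial.natDegree_C_mul_X _ (hN i)])
          (by simp [hN])
    simpa [hx, Algebra.smul_def] using this
  · let σ : MvPolynomial (Fin d) K →ₐ[K] MvPolynomial (Fin d) K :=
      MvPolynomial.aeval fun i => (N i)⁻¹ • .X i
    have hσ : (MvPolynomial.aeval fun i => ((1 : K) ⊗ₜ[k] (p i).1 : K ⊗[k] A)).comp σ = g := by
      ext i
      simp [σ, hx, hN]
    refine RingHom.IsIntegral.tower_top σ.toRingHom _ ?_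
    have : (MvPolynomial.aeval fun i => ((1 : K) ⊗ₜ[k] (p i).1 : K ⊗[k] A)).toRingHom.comp
      σ.toRingHom = g.toRingHom := congrArg AlgHom.toRingHom hσ
    rw [← hσ] at hgint
    exact hgint

variable (k) in
theorem exists_isIntegralElem_aeval_smul {σ : Type*} {x : σ → A}
    (hx : (MvPolynomial.aeval (R := K) fun i => ((1 : K) ⊗ₜ[k] x i : K ⊗[k] A)).IsIntegral)
    (a : A) : ∃ t : k, t ≠ 0 ∧
      (MvPolynomial.aeval (R := k) x).toRingHom.IsIntegralElem (t • a) := by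
  let g := MvPolynomial.aeval (R := K) fun i => ((1 : K) ⊗ₜ[k] x i : K ⊗[k] A)
  let ι : A →ₐ[k] K ⊗[k] A := Algebra.TensorProduct.includeRight
  let := (MvPolynomial.map (σ := σ) (algebraMap k K)).toAlgebra
  let := g.toRingHom.toAlgebra
  let := (g.toRingHom.comp (MvPolynomial.map (σ := σ) (algebraMap k K))).toAlgebra
  have : IsLocalization ((nonZeroDivisors k).map (MvPolynomial.C (σ := σ))) (MvPolynomial σ K) :=
    MvPolynomial.isLocalization _ _
  have : IsScalarTower (MvPolynomial σ k) (MvPolynomial σ K) (K ⊗[k] A) := .of_algebraMap_eq' rfl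
  obtain ⟨⟨_, t, ht, rfl⟩, p, hp, hp0⟩ :=
    IsIntegral.exists_multiple_integral_of_isLocalization
      ((nonZeroDivisors k).map (MvPolynomial.C (σ := σ))) (Rₘ := MvPolynomial σ K) (ι a) (hx (ι a))
  have hcomp : algebraMap (MvPolynomial σ k) (K ⊗[k] A) =
      (ι : A →+* K ⊗[k] A).comp (MvPolynomial.aeval x).toRingHom := by
    ext <;> simp [RingHom.algebraMap_toAlgebra, g, ι]
  have hsmul : MvPolynomial.C (σ := σ) t • ι a = ι (t • a) := by
    rw [Algebra.smul_def, hcomp]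
    simp [Algebra.smul_def]
  refine ⟨t, nonZeroDivisors.ne_zero ht, p, hp, ?_⟩
  apply includeRight_injective_of_isFractionRing (k := k) K
  rw [Submonoid.smul_def, hsmul, hcomp] at hp0
  rw [map_zero, ← hp0]
  exact Polynomial.hom_eval₂ _ _ (ι : A →+* K ⊗[k] A) _

end NoetherNormalization

theorem finite_adjoin_baseChange {k A : Type*} [CommRing k] [CommRing A] [Algebra k A]
    [Algebra.FiniteType k A] (B : Type*) [CommRing B] [Algebra k B] {σ : Type*} {x : σ → A}
    {G : Set A} (hG : Algebra.adjoin k G = ⊤) {t : k} (ht : IsUnit (algebraMap k B t))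
    (hint : ∀ a ∈ G, (MvPolynomial.aeval (R := k) x).toRingHom.IsIntegralElem (t • a)) :
    Module.Finite (Algebra.adjoin B (Set.range fun i => ((1 : B) ⊗ₜ[k] x i : B ⊗[k] A)))
      (B ⊗[k] A) := by
  set P := Algebra.adjoin B (Set.range fun i => ((1 : B) ⊗ₜ[k] x i : B ⊗[k] A))
  let ι : A →ₐ[k] B ⊗[k] A := Algebra.TensorProduct.includeRight
  let h : MvPolynomial σ k →ₐ[k] P := MvPolynomial.aeval fun i =>
    ⟨(1 : B) ⊗ₜ[k] x i, Algebra.subset_adjoin ⟨i, rfl⟩⟩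
  have hcomp : (P.val.restrictScalars k).comp h = ι.comp (MvPolynomial.aeval x) := by
    ext i
    simp [h, ι]
  have hmem (c : B) {z : B ⊗[k] A} (hz : IsIntegral P z) : IsIntegral P (c • z) := hz.smul c
  let Q : Subalgebra k A := ((integralClosure P (B ⊗[k] A)).restrictScalars k).comap ι
  have hQ : Q = ⊤ := by
    rw [eq_top_iff, ← hG]
    refine Algebra.adjoin_le fun a ha => ?_
    change IsIntegral P (ι a)
    obtain ⟨p, hp, hp0⟩ := hint a ha
    have hta : IsIntegral P (ι (t • a)) := by
      refine ⟨p.map h, hp.map _, ?_⟩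
      rw [Polynomial.eval₂_map]
      have : (algebraMap P (B ⊗[k] A)).comp (h : MvPolynomial σ k →+* P) =
        (ι : A →+* _).comp (MvPolynomial.aeval x).toRingHom := congrArg AlgHom.toRingHom hcomp
      rw [this]
      exact (Polynomial.hom_eval₂ _ _ (ι : A →+* B ⊗[k] A) _).symm.trans
        (by rw [hp0, map_zero])
    have := hmem (ht.unit⁻¹ : Bˣ) hta
    rwa [map_smul, ← algebraMap_smul B t, smul_smul, ht.val_inv_mul, one_smul] at this
  have : Algebra.IsIntegral P (B ⊗[k] A) := by
    refine ⟨fun z => ?_⟩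
    induction z with
    | zero => exact isIntegral_zero
    | add y z hy hz => exact hy.add hz
    | tmul c a =>
      have ha : a ∈ Q := hQ ▸ Algebra.mem_top
      have := hmem c (z := (1 : B) ⊗ₜ[k] a) ha
      rwa [TensorProduct.smul_tmul', smul_eq_mul, mul_one] at this
  have : Algebra.FiniteType P (B ⊗[k] A) := .of_restrictScalars_finiteType B P _
  exact Algebra.IsIntegral.finite

theorem inv_intCast_mem_ZS {s : ℤ} (hs : s ≠ 0) : (s : ℚ)⁻¹ ∈ ZS s.natAbs.primeFactors := by
  have hnat : ((s.natAbs : ℕ) : ℚ)⁻¹ ∈ ZS s.natAbs.primeFactors := by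
    have hprod := congrArg (Nat.cast : ℕ → ℚ)
      (Nat.prod_primeFactorsList (Int.natAbs_ne_zero.2 hs))
    rw [← hprod, Nat.cast_list_prod, List.prod_inv]
    refine Subring.list_prod_mem _ fun y hy => ?_
    simp only [List.mem_map] at hy
    obtain ⟨_, ⟨p, hp, rfl⟩, rfl⟩ := hy
    exact Subring.subset_closure (Or.inr ⟨p, List.mem_toFinset.2 hp, rfl⟩)
  rw [← Int.cast_natCast] at hnat
  rcases Int.natAbs_eq s with h | h
  · rwa [← h] at hnat
  · rw [← Int.neg_eq_comm.1 h.symm, Int.cast_neg, inv_neg] at hnat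
    exact neg_mem_iff.1 hnat

theorem isUnit_algebraMap_ZS {s t : ℤ} (hs : s ≠ 0) (ht : t ∣ s) :
    IsUnit (algebraMap ℤ (ZS s.natAbs.primeFactors) t) := by
  refine isUnit_of_dvd_unit (map_dvd _ ht)
    (IsUnit.of_mul_eq_one ⟨(s : ℚ)⁻¹, inv_intCast_mem_ZS hs⟩ (Subtype.ext ?_))
  exact mul_inv_cancel₀ (Int.cast_ne_zero.2 hs)

/-- For a finitely generated integral domain `A` of characteristic zero there is a finite
set `S` of primes such that `A_S = ℤ_S ⊗_ℤ A` is a free `ℤ_S`-module; moreover there are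
`x₁, …, x_d ∈ A` whose images in `ℚ ⊗_ℤ A` are algebraically independent over `ℚ` and such
that `A_S` is a finitely generated module over the `ℤ_S`-subalgebra generated by the
images of the `xᵢ`. -/
theorem stmt9 (A : Type) [CommRing A] [IsDomain A] [CharZero A]
    (hfg : Algebra.FiniteType ℤ A) :
    ∃ S : Finset ℕ, (∀ p ∈ S, p.Prime) ∧
      Module.Free (ZS S) ((ZS S) ⊗[ℤ] A) ∧
      ∃ (d : ℕ) (x : Fin d → A),
        AlgebraicIndependent ℚ (fun i => ((1 : ℚ) ⊗ₜ[ℤ] x i : ℚ ⊗[ℤ] A)) ∧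
        Module.Finite
          (Algebra.adjoin (ZS S)
            (Set.range fun i => ((1 : ZS S) ⊗ₜ[ℤ] x i : (ZS S) ⊗[ℤ] A)))
          ((ZS S) ⊗[ℤ] A) := by
  obtain ⟨s, hs, ι, b, hb, hspan⟩ := genericallyFree_of_finiteType (k := ℤ) A
  obtain ⟨d, x, hx, hint⟩ := exists_algebraicIndependent_isIntegral (k := ℤ) ℚ (A := A)
  choose t ht hta using exists_isIntegralElem_aeval_smul ℤ ℚ hint
  obtain ⟨G, hG⟩ := hfg.out
  have hT : ∏ a ∈ G, t a ≠ 0 := Finset.prod_ne_zero_iff.2 fun a _ => ht a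
  have hsT : s * ∏ a ∈ G, t a ≠ 0 := mul_ne_zero hs hT
  refine ⟨(s * ∏ a ∈ G, t a).natAbs.primeFactors, fun p => Nat.prime_of_mem_primeFactors,
    free_baseChange_of_isUnit _ (isUnit_algebraMap_ZS hsT (dvd_mul_right _ _)) hb hspan,
    d, x, hx, finite_adjoin_baseChange _ hG (isUnit_algebraMap_ZS hsT (dvd_mul_left _ _))
      fun a ha => ?_⟩
  obtain ⟨q, hq⟩ := Finset.dvd_prod_of_mem t ha
  rw [hq, mul_comm, mul_smul, Algebra.smul_def]
  refine RingHom.IsIntegralElem.mul _ ?_ (hta a)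
  rw [← MvPolynomial.aeval_C x q]
  exact RingHom.isIntegralElem_map _
end

section
/- Let A be an integral domain of characteristic zero that is finitely generated as a ℤ-algebra, and let a_1, …, a_m ∈ A be elements whose images in A ⊗_ℤ ℚ are linearly independent over ℚ. Then there exists a finite set S of primes such that for every prime p ∉ S, the images of a_1, …, a_m in A/pA are linearly independent over the field 𝔽_p = ℤ/pℤ. -/
open scoped TensorProduct

set_option synthInstance.maxHeartbeats 1000000
set_option maxHeartbeats 1000000

/-- In a reduced finitely generated algebra over a field, the ideals of finite codimension
separate every finite-dimensional subspace from zero. -/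
theorem Ideal.exists_finite_quotient_disjoint {k B : Type*} [Field k] [CommRing B] [IsReduced B]
    [Algebra k B] [Algebra.FiniteType k B] (W : Submodule k B) [Module.Finite k W] :
    ∃ I : Ideal B, Module.Finite k (B ⧸ I) ∧ Disjoint W (I.restrictScalars k) := by
  have : IsJacobsonRing B := isJacobsonRing_of_finiteType (A := k)
  suffices h : ∀ n : ℕ, ∀ I : Ideal B, Module.Finite k (B ⧸ I) →
      Module.finrank k ↥(W ⊓ I.restrictScalars k) = n →
      ∃ J : Ideal B, Module.Finite k (B ⧸ J) ∧ Disjoint W (J.restrictScalars k) from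
    h _ ⊤ inferInstance rfl
  intro n
  induction n using Nat.strong_induction_on with
  | _ n ih =>
    intro I hI hn
    by_cases hd : Disjoint W (I.restrictScalars k)
    · exact ⟨I, hI, hd⟩
    obtain ⟨w, ⟨hwW, hwI⟩, hw0⟩ := Submodule.exists_mem_ne_zero_of_ne_bot (mt disjoint_iff.2 hd)
    obtain ⟨M, hM, hwM⟩ : ∃ M : Ideal B, M.IsMaximal ∧ w ∉ M := by
      by_contra! h
      have hw : w ∈ (⊥ : Ideal B).jacobson :=
        Ideal.mem_sInf.2 fun {J} hJ => h J hJ.2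
      rw [IsJacobsonRing.out ‹_› (Ideal.isRadical_bot)] at hw
      exact hw0 hw
    let : Field (B ⧸ M) := Ideal.Quotient.field M
    have : Module.Finite k (B ⧸ M) := finite_of_finite_type_of_isJacobsonRing k (B ⧸ M)
    have hIM : Module.Finite k (B ⧸ (I ⊓ M)) := by
      let f : B ⧸ (I ⊓ M) →ₗ[k] (B ⧸ I) × (B ⧸ M) :=
        (Ideal.Quotient.factorₐ k inf_le_left).toLinearMap.prod
          (Ideal.Quotient.factorₐ k inf_le_right).toLinearMap
      refine Module.Finite.of_injective f ?_
      rw [injective_iff_map_eq_zero]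
      intro x hx
      obtain ⟨x, rfl⟩ := Ideal.Quotient.mk_surjective x
      obtain ⟨h₁, h₂⟩ := Prod.ext_iff.1 hx
      exact Ideal.Quotient.eq_zero_iff_mem.2
        ⟨Ideal.Quotient.eq_zero_iff_mem.1 h₁, Ideal.Quotient.eq_zero_iff_mem.1 h₂⟩
    refine ih _ ?_ (I ⊓ M) hIM rfl
    rw [← hn]
    refine Submodule.finrank_lt_finrank_of_lt (lt_of_le_of_ne ?_ fun h => hwM ?_)
    · exact inf_le_inf_left W fun x hx => hx.1
    · exact (h.ge ⟨hwW, hwI⟩ : w ∈ W ⊓ (I ⊓ M).restrictScalars k).2.2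

/-- A finitely generated ring with a representation by rational matrices is, for all but finitely
many primes `p`, represented by `p`-integral matrices; hence elements with linearly independent
images stay linearly independent modulo `p`. -/
theorem exists_finset_primes_dvd_of_linearIndependent_matrix {A n ι : Type*} [CommRing A]
    [Algebra.FiniteType ℤ A] [Fintype n] [DecidableEq n] [Fintype ι] (φ : A →+* Matrix n n ℚ)
    (a : ι → A) (hli : LinearIndependent ℚ fun i => φ (a i)) :
    ∃ S : Finset ℕ, (∀ p ∈ S, p.Prime) ∧ ∀ p : ℕ, p.Prime → p ∉ S →
      ∀ c : ι → ℤ, (∑ i, c i • a i) ∈ Ideal.span {(p : A)} → ∀ i, (p : ℤ) ∣ c i := by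
  classical
  obtain ⟨s, hs⟩ := Algebra.FiniteType.out (R := ℤ) (A := A)
  obtain ⟨g, hg⟩ := LinearMap.exists_leftInverse_of_injective
    (Fintype.linearCombination ℚ fun i => φ (a i))
    (LinearMap.ker_eq_bot.2 (linearIndependent_iff_injective_fintypeLinearCombination.1 hli))
  have hga (i : ι) : g (φ (a i)) = Pi.single i 1 := by
    simpa using LinearMap.congr_fun hg (Pi.single i 1)
  let D : Finset ℚ :=
    (s.biUnion fun x => Finset.univ.image fun jk : n × n => φ x jk.1 jk.2) ∪
      Finset.univ.image fun ijk : ι × n × n => g (Matrix.single ijk.2.1 ijk.2.2 1) ijk.1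
  refine ⟨D.biUnion fun q => q.den.primeFactors, fun p hp => ?_, fun p hp hpS c hc i => ?_⟩
  · obtain ⟨q, -, hq⟩ := Finset.mem_biUnion.1 hp
    exact Nat.prime_of_mem_primeFactors hq
  have : Fact p.Prime := ⟨hp⟩
  let R : Subring ℚ := (PadicInt.subring p).comap (Rat.castHom ℚ_[p])
  have hD : ∀ q ∈ D, q ∈ R := fun q hq => Padic.norm_rat_le_one fun h =>
    hpS (Finset.mem_biUnion.2 ⟨q, hq, Nat.mem_primeFactors.2 ⟨hp, h, q.den_nz⟩⟩)
  have hφ (x : A) : φ x ∈ R.matrix := by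
    have hx : x ∈ Algebra.adjoin ℤ (s : Set A) := hs ▸ Algebra.mem_top
    induction hx using Algebra.adjoin_induction with
    | mem x hx =>
      intro j k
      refine hD _ (Finset.mem_union_left _ (Finset.mem_biUnion.2 ⟨x, hx, ?_⟩))
      exact Finset.mem_image_of_mem (fun jk : n × n => φ x jk.1 jk.2) (Finset.mem_univ (j, k))
    | algebraMap r => simp
    | add x y _ _ hx hy => rw [map_add]; exact add_mem hx hy
    | mul x y _ _ hx hy => rw [map_mul]; exact mul_mem hx hy
  have hgφ (x : A) : g (φ x) i ∈ R := by
    rw [Matrix.matrix_eq_sum_single (φ x)]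
    simp only [map_sum, Finset.sum_apply]
    refine sum_mem fun j _ => sum_mem fun k _ => ?_
    rw [← mul_one (φ x j k), ← smul_eq_mul, ← Matrix.smul_single, map_smul, Pi.smul_apply,
      smul_eq_mul]
    refine mul_mem (hφ x j k) (hD _ (Finset.mem_union_right _ ?_))
    exact Finset.mem_image_of_mem
      (fun ijk : ι × n × n => g (Matrix.single ijk.2.1 ijk.2.2 1) ijk.1) (Finset.mem_univ (i, j, k))
  obtain ⟨b, hb⟩ := Ideal.mem_span_singleton'.1 hc
  have hcb : (c i : ℚ) = g (φ b) i * p := by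
    have h := congrArg (fun x => g (φ x) i) hb
    have hp' : g (φ b * (p : Matrix n n ℚ)) = (p : ℚ) • g (φ b) := by
      rw [← map_smul, ← nsmul_eq_mul', Nat.cast_smul_eq_nsmul]
    simp only [map_mul, map_natCast, hp', map_sum, map_zsmul, hga, Finset.sum_apply,
      Pi.smul_apply, smul_eq_mul, Pi.single_apply] at h
    rw [mul_comm, h]
    simp
  rw [← PadicInt.norm_int_lt_one_iff_dvd, PadicInt.norm_intCast_eq_padic_norm]
  have hcast : ((c i : ℤ) : ℚ_[p]) = ((g (φ b) i : ℚ) : ℚ_[p]) * p := by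
    exact_mod_cast congrArg (Rat.cast (K := ℚ_[p])) hcb
  rw [hcast, norm_mul]
  exact (mul_le_of_le_one_left (norm_nonneg _) (hgφ b)).trans_lt Padic.norm_p_lt_one

/-- If a finitely generated ring maps to a reduced `ℚ`-algebra, then elements with `ℚ`-linearly
independent images stay linearly independent modulo all but finitely many primes. -/
theorem exists_finset_primes_dvd_of_linearIndependent_map {A K ι : Type*} [CommRing A]
    [Algebra.FiniteType ℤ A] [CommRing K] [IsReduced K] [Algebra ℚ K] [Fintype ι] (φ : A →+* K)
    (a : ι → A) (hli : LinearIndependent ℚ fun i => φ (a i)) :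
    ∃ S : Finset ℕ, (∀ p ∈ S, p.Prime) ∧ ∀ p : ℕ, p.Prime → p ∉ S →
      ∀ c : ι → ℤ, (∑ i, c i • a i) ∈ Ideal.span {(p : A)} → ∀ i, (p : ℤ) ∣ c i := by
  let f : ℚ ⊗[ℤ] A →ₐ[ℚ] K :=
    Algebra.TensorProduct.lift (Algebra.ofId ℚ _) φ.toIntAlgHom
      fun _ _ => Commute.all _ _
  have hfin : Algebra.FiniteType ℚ f.range :=
    .of_surjective f.rangeRestrict f.rangeRestrict_surjective
  have : IsReduced f.range :=
    isReduced_of_injective f.range.val Subtype.val_injective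
  let ψ : A →+* f.range := f.rangeRestrict.toRingHom.comp
    (Algebra.TensorProduct.includeRight (R := ℤ) (A := ℚ)).toRingHom
  have hliB : LinearIndependent ℚ fun i => ψ (a i) := by
    refine LinearIndependent.of_comp f.range.val.toLinearMap ?_
    convert hli using 2
    simp [ψ, f]
  let W := Submodule.span ℚ (Set.range fun i => ψ (a i))
  have : Module.Finite ℚ W := .span_of_finite ℚ (Set.finite_range _)
  obtain ⟨I, hI, hWI⟩ := Ideal.exists_finite_quotient_disjoint W
  let b := Module.finBasis ℚ (f.range ⧸ I)
  refine exists_finset_primes_dvd_of_linearIndependent_matrix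
    ((Algebra.leftMulMatrix b).toRingHom.comp ((Ideal.Quotient.mk I).comp ψ)) a ?_
  have hliL := hliB.map (f := (Ideal.Quotient.mkₐ ℚ I).toLinearMap) (by
    convert hWI
    ext x
    exact Ideal.Quotient.eq_zero_iff_mem)
  exact hliL.map' (Algebra.leftMulMatrix b).toLinearMap
    (LinearMap.ker_eq_bot.2 (Algebra.leftMulMatrix_injective b))

/-- Linear independence over `ℤ` becomes linear independence over `ℚ` along an injective ring
homomorphism to a `ℚ`-algebra. -/
theorem LinearIndependent.rat_of_int_of_injective {A K ι : Type*} [Ring A] [Ring K] [Algebra ℚ K]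
    {a : ι → A} (hli : LinearIndependent ℤ a) {φ : A →+* K} (hφ : Function.Injective φ) :
    LinearIndependent ℚ fun i => φ (a i) := by
  rw [← LinearIndependent.iff_fractionRing ℤ ℚ]
  exact hli.map' φ.toIntAlgHom.toLinearMap (LinearMap.ker_eq_bot.2 hφ)

/-- If `A` is a finitely generated integral domain of characteristic zero and
`a₁, …, a_m ∈ A` have `ℚ`-linearly independent images in `ℚ ⊗_ℤ A`, then there is a finite
set `S` of primes such that for every prime `p ∉ S` the images of the `aᵢ` in `A/pA` are
linearly independent over `𝔽_p`: any integral relation `∑ cᵢ aᵢ ≡ 0 (mod p)` forces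
`p ∣ cᵢ` for all `i`. -/
theorem stmt10 (A : Type) [CommRing A] [IsDomain A] [CharZero A]
    (hfg : Algebra.FiniteType ℤ A) (m : ℕ) (a : Fin m → A)
    (hli : LinearIndependent ℚ (fun i => ((1 : ℚ) ⊗ₜ[ℤ] a i : ℚ ⊗[ℤ] A))) :
    ∃ S : Finset ℕ, (∀ p ∈ S, p.Prime) ∧
      ∀ p : ℕ, p.Prime → p ∉ S →
        ∀ c : Fin m → ℤ, (∑ i, c i • a i) ∈ Ideal.span {(p : A)} →
          ∀ i, (p : ℤ) ∣ c i := by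
  have hliA : LinearIndependent ℤ a :=
    LinearIndependent.of_comp (TensorProduct.mk ℤ ℚ A 1) (hli.restrict_scalars' ℤ)
  have : CharZero (FractionRing A) := charZero_of_injective_algebraMap (IsFractionRing.injective A _)
  exact exists_finset_primes_dvd_of_linearIndependent_map (algebraMap A (FractionRing A)) a
    (hliA.rat_of_int_of_injective (IsFractionRing.injective A _))
end

section
/- Let S be a finite set of primes, ℤ_S the ring of S-integers, B_S = ℤ_S[x_1, …, x_d] a polynomial ring, and A_S an integral domain containing B_S as a subring such that A_S is finitely generated as a B_S-module. Let a_1, …, a_m ∈ A_S be elements that are linearly independent over ℚ. Then there exists D > 0, depending on a_1, …, a_m, such that for every integer vector (n_1, …, n_m) ∈ ℤ^m, the element ∑_{i=1}^m n_i a_i is a root of some monic polynomial Q(T) ∈ B_S[T] whose height is at most D. -/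
namespace MvPolynomial

variable {σ R : Type*} [CommRing R]

theorem totalDegree_zsmul_le (n : ℤ) (p : MvPolynomial σ R) :
    (n • p).totalDegree ≤ p.totalDegree := by
  rw [← Int.cast_smul_eq_zsmul R]
  exact totalDegree_smul_le (n : R) p

/-- If the coefficients of `P` and `Q` have total degree at most `D` and `E`, those of `P * Q`
have total degree at most `D + E`. -/
theorem totalDegree_coeff_mul_le {P Q : Polynomial (MvPolynomial σ R)} {D E : ℕ}
    (hP : ∀ i, (P.coeff i).totalDegree ≤ D) (hQ : ∀ i, (Q.coeff i).totalDegree ≤ E) (i : ℕ) :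
    ((P * Q).coeff i).totalDegree ≤ D + E := by
  rw [Polynomial.coeff_mul]
  exact totalDegree_finsetSum_le fun x _ =>
    (totalDegree_mul _ _).trans (Nat.add_le_add (hP x.1) (hQ x.2))

theorem totalDegree_coeff_prod_le {ι : Type*} (s : Finset ι)
    {P : ι → Polynomial (MvPolynomial σ R)} {D : ℕ}
    (hP : ∀ j i, ((P j).coeff i).totalDegree ≤ D) (i : ℕ) :
    ((∏ j ∈ s, P j).coeff i).totalDegree ≤ s.card * D := by
  classical
  induction s using Finset.induction_on generalizing i with
  | empty =>
    rw [Finset.prod_empty, Polynomial.coeff_one]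
    split_ifs <;> simp
  | insert j s hj ih =>
    rw [Finset.prod_insert hj, Finset.card_insert_of_notMem hj, add_mul, one_mul, add_comm]
    exact totalDegree_coeff_mul_le (hP j) ih i

/-- The characteristic polynomial of a matrix whose entries have total degree at most `D` has
coefficients of total degree at most `card ι * D`. -/
theorem totalDegree_coeff_charpoly_le {ι : Type*} [Fintype ι] [DecidableEq ι]
    {M : Matrix ι ι (MvPolynomial σ R)} {D : ℕ} (hM : ∀ j k, (M j k).totalDegree ≤ D) (i : ℕ) :
    (M.charpoly.coeff i).totalDegree ≤ Fintype.card ι * D := by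
  have hchar : ∀ j k i, ((M.charmatrix j k).coeff i).totalDegree ≤ D := by
    intro j k i
    rw [Matrix.charmatrix_apply, Polynomial.coeff_sub]
    refine (totalDegree_sub _ _).trans (max_le ?_ ?_)
    · rw [Matrix.diagonal_apply]
      split_ifs
      · rw [Polynomial.coeff_X]
        split_ifs <;> simp
      · simp
    · rw [Polynomial.coeff_C]
      split_ifs
      · exact hM j k
      · simp
  rw [Matrix.charpoly, Matrix.det_apply, Polynomial.finsetSum_coeff]
  refine totalDegree_finsetSum_le fun τ _ => ?_
  rw [Units.smul_def, Polynomial.coeff_smul]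
  exact (totalDegree_zsmul_le _ _).trans
    (totalDegree_coeff_prod_le Finset.univ (fun j => hchar (τ j) j) i)

end MvPolynomial

theorem Matrix.isRepresentation.aeval_toEnd_charpoly {ι R M : Type*} [Fintype ι] [DecidableEq ι]
    [CommRing R] [AddCommGroup M] [Module R M] (b : ι → M)
    (hb : Submodule.span R (Set.range b) = ⊤) (N : Matrix.isRepresentation R b) :
    Polynomial.aeval (Matrix.isRepresentation.toEnd R b hb N) N.1.charpoly = 0 := by
  rw [Polynomial.aeval_algHom_apply, ← map_zero (Matrix.isRepresentation.toEnd R b hb)]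
  congr 1
  ext1
  rw [Polynomial.aeval_subalgebra_coe, Matrix.aeval_self_charpoly, Subalgebra.coe_zero]


set_option synthInstance.maxHeartbeats 1000000
set_option maxHeartbeats 1000000

/-- Let `B_S = ℤ_S[x₁, …, x_d]` and let `A_S` be an integral domain containing `B_S` and
finitely generated as a `B_S`-module. If `a₁, …, a_m ∈ A_S` are linearly independent over
`ℚ` (equivalently, over `ℤ`), then there is `D > 0` such that every integral linear
combination `∑ nᵢ aᵢ` is a root of a monic polynomial `Q ∈ B_S[T]` of height at most `D`,
i.e. all coefficients of `Q` have total degree at most `D`. -/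
theorem stmt11 (S : Finset ℕ) (hS : ∀ p ∈ S, p.Prime) (d : ℕ)
    (A : Type) [CommRing A] [IsDomain A]
    [Algebra (MvPolynomial (Fin d) (ZS S)) A]
    (hinj : Function.Injective (algebraMap (MvPolynomial (Fin d) (ZS S)) A))
    (hfin : Module.Finite (MvPolynomial (Fin d) (ZS S)) A)
    (m : ℕ) (a : Fin m → A) (hli : LinearIndependent ℤ a) :
    ∃ D : ℕ, 0 < D ∧ ∀ nv : Fin m → ℤ,
      ∃ Q : Polynomial (MvPolynomial (Fin d) (ZS S)), Q.Monic ∧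
        (∀ i : ℕ, (Q.coeff i).totalDegree ≤ D) ∧
        Polynomial.aeval (∑ i, nv i • a i) Q = 0 := by
  classical
  obtain ⟨k, s, hs⟩ := Module.Finite.exists_fin (R := MvPolynomial (Fin d) (ZS S)) (M := A)
  choose N hN using fun j => Matrix.isRepresentation.toEnd_surjective
    (MvPolynomial (Fin d) (ZS S)) s hs (Algebra.lmul (MvPolynomial (Fin d) (ZS S)) A (a j))
  let E : ℕ := ∑ j, ∑ p, ∑ q, ((N j).1 p q).totalDegree
  have hE : ∀ j p q, ((N j).1 p q).totalDegree ≤ E := fun j p q =>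
    calc ((N j).1 p q).totalDegree
        ≤ ∑ q, ((N j).1 p q).totalDegree :=
          Finset.single_le_sum (f := fun q => ((N j).1 p q).totalDegree)
            (fun _ _ => Nat.zero_le _) (Finset.mem_univ q)
      _ ≤ ∑ p, ∑ q, ((N j).1 p q).totalDegree :=
          Finset.single_le_sum (f := fun p => ∑ q, ((N j).1 p q).totalDegree)
            (fun _ _ => Nat.zero_le _) (Finset.mem_univ p)
      _ ≤ E :=
          Finset.single_le_sum (f := fun j => ∑ p, ∑ q, ((N j).1 p q).totalDegree)
            (fun _ _ => Nat.zero_le _) (Finset.mem_univ j)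
  refine ⟨k * E + 1, Nat.succ_pos _, fun nv => ?_⟩
  let L := ∑ j, (nv j : MvPolynomial (Fin d) (ZS S)) • N j
  have hL : Matrix.isRepresentation.toEnd (MvPolynomial (Fin d) (ZS S)) s hs L =
      Algebra.lmul (MvPolynomial (Fin d) (ZS S)) A (∑ j, nv j • a j) := by
    simp only [L, map_sum, map_smul, hN, ← Int.cast_smul_eq_zsmul (MvPolynomial (Fin d) (ZS S))]
  have hentry : ∀ p q, (L.1 p q).totalDegree ≤ E := by
    intro p q
    have hpq : L.1 p q = ∑ j, nv j • (N j).1 p q := by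
      simp [L, Matrix.sum_apply, Matrix.smul_apply, zsmul_eq_mul]
    rw [hpq]
    exact MvPolynomial.totalDegree_finsetSum_le fun j _ =>
      (MvPolynomial.totalDegree_zsmul_le _ _).trans (hE j p q)
  refine ⟨L.1.charpoly, L.1.charpoly_monic, fun i => ?_, ?_⟩
  · refine (MvPolynomial.totalDegree_coeff_charpoly_le hentry i).trans ?_
    rw [Fintype.card_fin]
    exact Nat.le_succ _
  · apply Algebra.lmul_injective (R := MvPolynomial (Fin d) (ZS S))
    rw [map_zero, ← Polynomial.aeval_algHom_apply, ← hL]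
    exact Matrix.isRepresentation.aeval_toEnd_charpoly s hs L
end

section
/- Let I be a finite index set and let {G_i}_{i ∈ I} be a family of finite groups such that for all i ≠ i', the groups G_i and G_{i'} have no nontrivial common homomorphic image, i.e. every group K admitting surjective group homomorphisms from both G_i and G_{i'} is trivial. Let H be a subgroup of G = ∏_{i ∈ I} G_i such that for every i the projection π_i : G → G_i maps H onto G_i. Then H = G. -/
/-- A proper normal subgroup of a finite group lies in a maximal one. -/
theorem Subgroup.exists_le_maximal_normal {A : Type*} [Group A] [Finite A] (K : Subgroup A)
    (hK : K.Normal) (hne : K ≠ ⊤) :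
    ∃ M : Subgroup A, K ≤ M ∧ Maximal (fun N : Subgroup A => N.Normal ∧ N ≠ ⊤) M :=
  (Set.toFinite {N : Subgroup A | N.Normal ∧ N ≠ ⊤}).exists_le_maximal ⟨hK, hne⟩

/-- The quotient of a group by a maximal normal subgroup is simple. -/
theorem QuotientGroup.isSimpleGroup_of_maximal {A : Type*} [Group A] (M : Subgroup A) [M.Normal]
    (hM : Maximal (fun N : Subgroup A => N.Normal ∧ N ≠ ⊤) M) : IsSimpleGroup (A ⧸ M) := by
  have : Nontrivial (A ⧸ M) := QuotientGroup.nontrivial_iff.mpr hM.prop.2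
  refine ⟨fun N hN => ?_⟩
  have hle : M ≤ N.comap (QuotientGroup.mk' M) := QuotientGroup.le_comap_mk' M N
  have hmap := Subgroup.map_comap_eq_self_of_surjective (QuotientGroup.mk'_surjective M) N
  by_cases htop : N.comap (QuotientGroup.mk' M) = ⊤
  · right
    rw [← hmap, htop, Subgroup.map_top_of_surjective _ (QuotientGroup.mk'_surjective M)]
  · left
    have heq := hM.eq_of_le ⟨hN.comap _, htop⟩ hle
    rw [← hmap, ← heq, QuotientGroup.map_mk'_self]

/-- A homomorphism from a finite product onto a simple group is already onto on some factor. -/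
theorem MonoidHom.exists_surjective_comp_mulSingle {I : Type*} [Finite I] [DecidableEq I]
    {G : I → Type*} [∀ i, Group (G i)] {S : Type*} [Group S] [IsSimpleGroup S]
    (f : (∀ i, G i) →* S) (hf : Function.Surjective f) :
    ∃ j, Function.Surjective (f.comp (MonoidHom.mulSingle G j)) := by
  by_contra! hno
  have hker (j : I) (x : G j) : Pi.mulSingle j x ∈ f.ker := by
    have hnormal : (f.comp (MonoidHom.mulSingle G j)).range.Normal := by
      rw [MonoidHom.range_comp]
      refine Subgroup.Normal.map ⟨?_⟩ f hf
      rintro _ ⟨y, rfl⟩ g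
      refine ⟨g j * y * (g j)⁻¹, ?_⟩
      ext k
      by_cases hk : k = j
      · subst hk; simp
      · simp [hk]
    rcases hnormal.eq_bot_or_eq_top with h | h
    · exact (Subgroup.mem_bot.mp (h ▸ ⟨x, rfl⟩ : f (Pi.mulSingle j x) ∈ (⊥ : Subgroup S)))
    · exact absurd (MonoidHom.range_eq_top.mp h) (hno j)
  obtain ⟨s, hs⟩ := exists_ne (1 : S)
  obtain ⟨g, rfl⟩ := hf s
  exact hs (Subgroup.pi_mem_of_mulSingle_mem g fun j => hker j (g j))

/-- If `H ≤ ∏ᵢ G_i` maps onto `∏_{j ∈ s} G_j` and onto `G_i`, and `G_i` has no nontrivial common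
homomorphic image with any `G_j`, `j ∈ s`, then `H` maps onto `G_i × ∏_{j ∈ s} G_j`. -/
theorem Subgroup.exists_mem_eqOn_insert {I : Type} [Finite I] [DecidableEq I] {G : I → Type}
    [∀ i, Group (G i)] (H : Subgroup (∀ i, G i)) (s : Finset I) (i : I) [Finite (G i)]
    (hcom : ∀ j ∈ s, ∀ (K : Type) [Group K] (φ : G i →* K) (ψ : G j →* K),
      Function.Surjective φ → Function.Surjective ψ → Subsingleton K)
    (hi : ∀ x : G i, ∃ h ∈ H, h i = x)
    (hs : ∀ g : ∀ i, G i, ∃ h ∈ H, ∀ j ∈ s, h j = g j) (g : ∀ i, G i) :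
    ∃ h ∈ H, ∀ j ∈ insert i s, h j = g j := by
  let K : Subgroup (G i) :=
    (H ⊓ ⨅ j ∈ s, (Pi.evalMonoidHom G j).ker).map (Pi.evalMonoidHom G i)
  have mem_K {x : G i} : x ∈ K ↔ ∃ h ∈ H, (∀ j ∈ s, h j = 1) ∧ h i = x := by
    simp only [K, Subgroup.mem_map, Subgroup.mem_inf, Subgroup.mem_iInf, MonoidHom.mem_ker,
      Pi.evalMonoidHom_apply, and_assoc]
  have hK : K.Normal := by
    refine ⟨fun x hx y => ?_⟩
    obtain ⟨h, hH, h1, rfl⟩ := mem_K.mp hx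
    obtain ⟨k, kH, rfl⟩ := hi y
    exact mem_K.mpr ⟨k * h * k⁻¹, H.mul_mem (H.mul_mem kH hH) (H.inv_mem kH),
      fun j hj => by simp [h1 j hj], rfl⟩
  have hKtop : K = ⊤ := by
    by_contra hne
    obtain ⟨M, hKM, hM⟩ := K.exists_le_maximal_normal hK hne
    have : M.Normal := hM.prop.1
    have : IsSimpleGroup (G i ⧸ M) := QuotientGroup.isSimpleGroup_of_maximal M hM
    choose lift lift_mem lift_eq using hs
    have mk_lift (g h : ∀ i, G i) (hH : h ∈ H) (hgh : ∀ j ∈ s, h j = g j) :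
        (lift g i : G i ⧸ M) = h i :=
      QuotientGroup.eq.mpr <| hKM <| mem_K.mpr ⟨(lift g)⁻¹ * h,
        H.mul_mem (H.inv_mem (lift_mem g)) hH, fun j hj => by simp [lift_eq g j hj, hgh j hj], rfl⟩
    let f : (∀ i, G i) →* G i ⧸ M := MonoidHom.mk' (fun g => (lift g i : G i ⧸ M)) fun a b =>
      mk_lift (a * b) (lift a * lift b) (H.mul_mem (lift_mem a) (lift_mem b))
        fun j hj => by simp [lift_eq _ j hj]
    have hf : Function.Surjective f := fun q => by
      obtain ⟨x, rfl⟩ := QuotientGroup.mk_surjective q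
      obtain ⟨h, hH, rfl⟩ := hi x
      exact ⟨h, mk_lift h h hH fun _ _ => rfl⟩
    obtain ⟨j, hj⟩ := f.exists_surjective_comp_mulSingle hf
    by_cases hjs : j ∈ s
    · exact not_subsingleton (G i ⧸ M)
        (hcom j hjs _ (QuotientGroup.mk' M) _ (QuotientGroup.mk'_surjective M) hj)
    · obtain ⟨q, hq⟩ := exists_ne ((1 : G i) : G i ⧸ M)
      obtain ⟨x, rfl⟩ := hj q
      refine hq (mk_lift _ 1 H.one_mem fun k hk => ?_)
      have hkj : k ≠ j := fun h => hjs (h ▸ hk)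
      simp [hkj]
  obtain ⟨h, hH, hg⟩ := hs g
  obtain ⟨k, kH, k1, ki⟩ := mem_K.mp (hKtop ▸ Subgroup.mem_top ((h i)⁻¹ * g i))
  refine ⟨h * k, H.mul_mem hH kH, fun j hj => ?_⟩
  rcases Finset.mem_insert.mp hj with rfl | hj
  · simp [ki]
  · simp [hg j hj, k1 j hj]

/-- If `{G_i}` is a finite family of finite groups such that distinct members have no
nontrivial common homomorphic image, and `H ≤ ∏ᵢ G_i` surjects onto each factor, then
`H = ∏ᵢ G_i`. -/
theorem stmt12 (I : Type) [Fintype I] (G : I → Type) [∀ i, Group (G i)]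
    [∀ i, Finite (G i)]
    (hcom : ∀ i i' : I, i ≠ i' → ∀ (K : Type) [Group K],
      ∀ (φ : G i →* K) (ψ : G i' →* K),
        Function.Surjective φ → Function.Surjective ψ → Subsingleton K)
    (H : Subgroup (∀ i, G i))
    (hsurj : ∀ i : I, Function.Surjective fun h : H => (h : ∀ i, G i) i) :
    H = ⊤ := by
  classical
  have key (s : Finset I) : ∀ g : ∀ i, G i, ∃ h ∈ H, ∀ j ∈ s, h j = g j := by
    induction s using Finset.induction_on with
    | empty => exact fun g => ⟨1, H.one_mem, by simp⟩
    | insert i s his ih =>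
      refine H.exists_mem_eqOn_insert s i
        (fun j hj => hcom i j fun h => his (h ▸ hj)) (fun x => ?_) ih
      obtain ⟨h, hx⟩ := hsurj i x
      exact ⟨h, h.2, hx⟩
  refine (Subgroup.eq_top_iff' H).mpr fun g => ?_
  obtain ⟨h, hH, hg⟩ := key Finset.univ g
  rwa [← funext fun j => hg j (Finset.mem_univ j)]
end
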